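/- For every integer k ≥ 1, s(K_2, K_{(6k+5)/(3k+1)}) = (6k²+8k+3)/(6k²+11k+5) = 1 − (3k+2)/((k+1)(6k+5)). -/

import Mathlib

open scoped Classical

noncomputable section

/-- The circular complete graph `K_{p/q}`: vertices `v_0, …, v_{p-1}` with an edge
`v_i v_j` whenever `q ≤ |i - j| ≤ p - q`. -/
def circK (p q : ℕ) : SimpleGraph (Fin p) :=
  SimpleGraph.fromRel (fun i j =>
    q ≤ max i.val j.val - min i.val j.val ∧ max i.val j.val - min i.val j.val ≤ p - q)

/-- The complete graph on two vertices. -/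
def K2 : SimpleGraph (Fin 2) := ⊤

/-- The cycle graph on `n` vertices. -/
def cycleG (n : ℕ) : SimpleGraph (Fin n) :=
  SimpleGraph.fromRel (fun i j => (i.val + 1) % n = j.val)

/-- The total weight of the edges of `G` carried to edges of `H` by the vertex map `f`. -/
def cutWeight {α β : Type} [Fintype α] (G : SimpleGraph α) (H : SimpleGraph β)
    (w : Sym2 α → ℚ) (f : α → β) : ℝ :=
  ∑ e ∈ Finset.univ.filter (fun e : Sym2 α => e ∈ G.edgeSet ∧ Sym2.map f e ∈ H.edgeSet), (w e : ℝ)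

/-- `mc_H(G,w)`: the maximum over all vertex maps `f : V(G) → V(H)` of the total weight
of the edges of `G` mapped to edges of `H`. -/
def mcMax {α β : Type} [Fintype α] (H : SimpleGraph β) (G : SimpleGraph α)
    (w : Sym2 α → ℚ) : ℝ :=
  ⨆ f : α → β, cutWeight G H w f

/-- `s(M,N)`: the infimum over all finite simple graphs `G` with at least one edge and all
positive rational edge-weight functions `w` of `mc_M(G,w)/mc_N(G,w)`. -/
def sVal {α β : Type} (M : SimpleGraph α) (N : SimpleGraph β) : ℝ :=
  sInf { x : ℝ | ∃ (n : ℕ) (G : SimpleGraph (Fin n)) (w : Sym2 (Fin n) → ℚ),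
    G.edgeSet.Nonempty ∧ (∀ e ∈ G.edgeSet, 0 < w e) ∧
    x = mcMax M G w / mcMax N G w }

open Finset in
theorem aux_odd (p : ℕ) [NeZero p] (hp : Odd p) (x : ZMod p → ZMod 2) (d : ZMod p) :
    Odd (∑ t : ZMod p, if x t = x (t + d) then 1 else 0 : ℕ) := by
  rw [← ZMod.natCast_eq_one_iff_odd]
  have key : ∀ a b : ZMod 2, (((if a = b then 1 else 0 : ℕ)) : ZMod 2) = 1 + a + b := by decide
  rw [Nat.cast_sum, Finset.sum_congr rfl (fun t _ => key (x t) (x (t + d)))]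
  rw [Finset.sum_add_distrib, Finset.sum_add_distrib, show ∑ t, x (t + d) = ∑ t, x t from Equiv.sum_comp (Equiv.addRight d) x]
  rw [add_assoc, CharTwo.add_self_eq_zero]
  simpa using (ZMod.natCast_eq_one_iff_odd).2 hp

theorem aux_walk (p : ℕ) (x : ZMod p → ZMod 2) (d t : ZMod p) (m : ℕ) (hm : Even m) :
    1 ≤ (if x t = x (t + m * d) then 1 else 0 : ℕ) +
      ∑ i ∈ Finset.range m, (if x (t + i * d) = x (t + i * d + d) then 1 else 0 : ℕ) := by
  have key : ∀ a b : ZMod 2, (((if a = b then 1 else 0 : ℕ)) : ZMod 2) = 1 + a + b := by decide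
  have h2 : ∀ a b : ZMod 2, (1 + a + b) + (0 + a + b) = 1 := by decide
  have h3 : ∀ n : ℕ, ((∑ i ∈ Finset.range n,
      (if x (t + i * d) = x (t + i * d + d) then 1 else 0 : ℕ) : ℕ) : ZMod 2)
      = n + x t + x (t + n * d) := by
    intro n
    induction n with
    | zero => simp [CharTwo.add_self_eq_zero]
    | succ n ih =>
      rw [Finset.sum_range_succ, Nat.cast_add, ih, key]
      have : t + (n : ZMod p) * d + d = t + ((n + 1 : ℕ) : ZMod p) * d := by push_cast; ring
      rw [this]
      have h4 : ∀ a b c e : ZMod 2, a + b + c + (1 + c + e) = a + 1 + b + e := by decide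
      rw [h4]; push_cast; rfl
  rw [Nat.one_le_iff_ne_zero]
  intro h
  have := congrArg (Nat.cast : ℕ → ZMod 2) h
  rw [Nat.cast_add, key, h3, (ZMod.natCast_eq_zero_iff_even).2 hm, h2] at this
  simp at this

theorem aux_comb (k : ℕ) (x : ZMod (6*k+5) → ZMod 2) :
    6*k+4 ≤ (2*k+1) * (∑ t, if x t = x (t + ((3*k+1 : ℕ) : ZMod (6*k+5))) then 1 else 0 : ℕ)
      + (∑ t, if x t = x (t + ((3*k+2 : ℕ) : ZMod (6*k+5))) then 1 else 0 : ℕ) := by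
  have hp : Odd (6*k+5) := ⟨3*k+2, by ring⟩
  have hT := aux_odd (6*k+5) hp x ((3*k+1 : ℕ) : ZMod (6*k+5))
  have hS := aux_odd (6*k+5) hp x ((3*k+2 : ℕ) : ZMod (6*k+5))
  have hW : 6*k+5 ≤ (∑ t, if x t = x (t + ((3*k+2 : ℕ) : ZMod (6*k+5))) then 1 else 0 : ℕ)
     + (2*k+2) * (∑ t, if x t = x (t + ((3*k+1 : ℕ) : ZMod (6*k+5))) then 1 else 0 : ℕ) := by
    have h1 := Finset.sum_le_sum (s := Finset.univ) (fun (t : ZMod (6*k+5)) _ =>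
      aux_walk (6*k+5) x ((3*k+1 : ℕ) : ZMod (6*k+5)) t (2*k+2) ⟨k+1, by ring⟩)
    rw [Finset.sum_add_distrib, Finset.sum_comm] at h1
    have e1 : ((2*k+2 : ℕ) : ZMod (6*k+5)) * ((3*k+1 : ℕ) : ZMod (6*k+5)) = ((3*k+2 : ℕ) : ZMod (6*k+5)) := by
      have : (2*k+2)*(3*k+1) = 3*k+2 + (6*k+5) * k := by ring
      rw [← Nat.cast_mul, this, Nat.cast_add, Nat.cast_mul, ZMod.natCast_self]; simp
    have e2 : ∀ i : ℕ, (∑ t : ZMod (6*k+5), if x (t + i * ((3*k+1 : ℕ) : ZMod (6*k+5))) = x (t + i * ((3*k+1 : ℕ) : ZMod (6*k+5)) + ((3*k+1 : ℕ) : ZMod (6*k+5))) then 1 else 0 : ℕ)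
       = (∑ t, if x t = x (t + ((3*k+1 : ℕ) : ZMod (6*k+5))) then 1 else 0 : ℕ) := fun i =>
      Equiv.sum_comp (Equiv.addRight (i * ((3*k+1 : ℕ) : ZMod (6*k+5)))) (fun t => if x t = x (t + ((3*k+1 : ℕ) : ZMod (6*k+5))) then 1 else 0 : ZMod (6*k+5) → ℕ)
    rw [Finset.sum_congr rfl (fun i _ => e2 i), e1] at h1
    simpa [ZMod.card] using h1
  obtain ⟨a, ha⟩ := hT
  obtain ⟨b, hb⟩ := hS
  rw [ha, hb] at hW ⊢
  rcases Nat.eq_zero_or_pos a with rfl | h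
  · linarith
  · nlinarith

def psi (k : ℕ) (t : ZMod (6*k+5)) : Fin (6*k+5) := ⟨t.val, ZMod.val_lt t⟩

def phi (k : ℕ) (i : Fin (6*k+5)) : ZMod (6*k+5) := (i.val : ZMod (6*k+5))

theorem psi_phi (k : ℕ) (i : Fin (6*k+5)) : psi k (phi k i) = i := by
  ext; simp [psi, phi, ZMod.val_natCast, Nat.mod_eq_of_lt i.isLt]

theorem phi_psi (k : ℕ) (i : ZMod (6*k+5)) : phi k (psi k i) = i := by
  simp [psi, phi]

theorem adj_psi (k D : ℕ) (hD : D = 3*k+1 ∨ D = 3*k+2) (t : ZMod (6*k+5)) :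
    (circK (6*k+5) (3*k+1)).Adj (psi k t) (psi k (t + (D : ZMod (6*k+5)))) := by
  have hlt := ZMod.val_lt t
  have hv : (t + (D : ZMod (6*k+5))).val = t.val + D ∨
      (t + (D : ZMod (6*k+5))).val + (6*k+5) = t.val + D := by
    have hDl : D < 6*k+5 := by omega
    rw [ZMod.val_add, ZMod.val_natCast, Nat.mod_eq_of_lt hDl]
    rcases lt_or_ge (t.val + D) (6*k+5) with h | h
    · left; exact Nat.mod_eq_of_lt h
    · right
      rw [Nat.mod_eq_sub_mod h, Nat.mod_eq_of_lt (by omega)]; omega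
  have hlt2 := ZMod.val_lt (t + (D : ZMod (6*k+5)))
  simp only [circK, SimpleGraph.fromRel_adj, psi, ne_eq, Fin.mk.injEq]
  generalize (t + (D : ZMod (6*k+5))).val = b at *
  generalize t.val = a at *
  refine ⟨by omega, Or.inl ?_⟩
  omega

theorem adj_phi (k : ℕ) (i j : Fin (6*k+5)) (h : (circK (6*k+5) (3*k+1)).Adj i j) :
    ∃ D : ℕ, (D = 3*k+1 ∨ D = 3*k+2) ∧
      (phi k j = phi k i + (D : ZMod (6*k+5)) ∨ phi k i = phi k j + (D : ZMod (6*k+5))) := by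
  have hi := i.isLt
  have hj := j.isLt
  simp only [circK, SimpleGraph.fromRel_adj] at h
  have h2 := h.2
  have wrap : ∀ a b D : ℕ, (a = b + D ∨ a + (6*k+5) = b + D) →
      (a : ZMod (6*k+5)) = (b : ZMod (6*k+5)) + (D : ZMod (6*k+5)) := by
    rintro a b D (h | h)
    · rw [h]; push_cast; rfl
    · rw [← Nat.cast_add, ← h, Nat.cast_add, ZMod.natCast_self, add_zero]
  have : ∃ D : ℕ, (D = 3*k+1 ∨ D = 3*k+2) ∧
      ((j.val = i.val + D ∨ j.val + (6*k+5) = i.val + D) ∨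
       (i.val = j.val + D ∨ i.val + (6*k+5) = j.val + D)) := by
    by_cases hh : (j.val = i.val + (3*k+1) ∨ j.val + (6*k+5) = i.val + (3*k+1)) ∨
       (i.val = j.val + (3*k+1) ∨ i.val + (6*k+5) = j.val + (3*k+1))
    · exact ⟨3*k+1, Or.inl rfl, hh⟩
    · exact ⟨3*k+2, Or.inr rfl, by omega⟩
  obtain ⟨D, hD, h3⟩ := this
  refine ⟨D, hD, ?_⟩
  rcases h3 with h3 | h3
  · exact Or.inl (wrap _ _ _ h3)
  · exact Or.inr (wrap _ _ _ h3)

/-- the cut of type A -/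
def cA (k : ℕ) (t : ZMod (6*k+5)) : Fin 2 := if t.val < 3*k+2 then 0 else 1
/-- the cut of type B -/
def cB (k : ℕ) (t : ZMod (6*k+5)) : Fin 2 :=
  if Even ((((2*k+1 : ℕ) : ZMod (6*k+5)) * t).val) then 0 else 1

theorem val_cases (k D : ℕ) (hDl : D < 6*k+5) (t : ZMod (6*k+5)) :
    (t.val + D < 6*k+5 ∧ (t + (D : ZMod (6*k+5))).val = t.val + D) ∨
      (t + (D : ZMod (6*k+5))).val + (6*k+5) = t.val + D := by
  have hlt := ZMod.val_lt t
  rw [ZMod.val_add, ZMod.val_natCast, Nat.mod_eq_of_lt hDl]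
  rcases lt_or_ge (t.val + D) (6*k+5) with h | h
  · left; exact ⟨h, Nat.mod_eq_of_lt h⟩
  · right
    rw [Nat.mod_eq_sub_mod h, Nat.mod_eq_of_lt (by omega)]; omega

theorem card_le_of_val (k : ℕ) (P : ZMod (6*k+5) → Prop) [DecidablePred P] (s : Finset ℕ)
    (h : ∀ t, P t → t.val ∈ s) : (∑ t, if P t then 1 else 0 : ℕ) ≤ s.card := by
  rw [← Finset.card_filter]
  refine Finset.card_le_card_of_injOn ZMod.val (fun t ht => ?_)
    (fun a _ b _ hab => ZMod.val_injective _ hab)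
  simp at ht
  exact h t ht

theorem cA_h (k : ℕ) : (∑ t, if cA k t = cA k (t + ((3*k+1 : ℕ) : ZMod (6*k+5))) then 1 else 0 : ℕ) ≤ 3 := by
  refine (card_le_of_val k _ {0, 3*k+2, 3*k+3} ?_).trans Finset.card_le_three
  intro t ht
  have hlt := ZMod.val_lt t
  have := val_cases k (3*k+1) (by omega) t
  simp only [cA] at ht
  simp only [Finset.mem_insert, Finset.mem_singleton]
  split_ifs at ht <;> omega

theorem cA_l (k : ℕ) : (∑ t, if cA k t = cA k (t + ((3*k+2 : ℕ) : ZMod (6*k+5))) then 1 else 0 : ℕ) ≤ 1 := by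
  refine (card_le_of_val k _ {3*k+2} ?_).trans (Finset.card_singleton _).le
  intro t ht
  have hlt := ZMod.val_lt t
  have := val_cases k (3*k+2) (by omega) t
  simp only [cA] at ht
  simp only [Finset.mem_singleton]
  split_ifs at ht <;> omega

theorem c_inv (k : ℕ) : ((2*k+1 : ℕ) : ZMod (6*k+5)) * ((3*k+1 : ℕ) : ZMod (6*k+5)) = ((1 : ℕ) : ZMod (6*k+5)) := by
  have : (2*k+1)*(3*k+1) = 1 + (6*k+5) * k := by ring
  rw [← Nat.cast_mul, this, Nat.cast_add, Nat.cast_mul, ZMod.natCast_self]; simp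

theorem c_l (k : ℕ) : ((2*k+1 : ℕ) : ZMod (6*k+5)) * ((3*k+2 : ℕ) : ZMod (6*k+5)) = ((2*k+2 : ℕ) : ZMod (6*k+5)) := by
  have : (2*k+1)*(3*k+2) = (2*k+2) + (6*k+5) * k := by ring
  rw [← Nat.cast_mul, this, Nat.cast_add, Nat.cast_mul, ZMod.natCast_self]; simp

theorem card_le_of_val_mul (k : ℕ) (P : ZMod (6*k+5) → Prop) [DecidablePred P] (s : Finset ℕ)
    (h : ∀ t, P t → (((2*k+1 : ℕ) : ZMod (6*k+5)) * t).val ∈ s) :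
    (∑ t, if P t then 1 else 0 : ℕ) ≤ s.card := by
  rw [← Finset.card_filter]
  refine Finset.card_le_card_of_injOn (fun t => (((2*k+1 : ℕ) : ZMod (6*k+5)) * t).val) (fun t ht => ?_)
    (fun a _ b _ hab => ?_)
  · simp at ht
    exact h t ht
  · have h1 := ZMod.val_injective _ hab
    have h2 := congrArg (fun z => ((3*k+1 : ℕ) : ZMod (6*k+5)) * z) h1
    simp only [← mul_assoc] at h2
    rw [mul_comm ((3*k+1 : ℕ) : ZMod (6*k+5)), c_inv] at h2
    simpa using h2

theorem cB_h (k : ℕ) : (∑ t, if cB k t = cB k (t + ((3*k+1 : ℕ) : ZMod (6*k+5))) then 1 else 0 : ℕ) ≤ 1 := by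
  refine (card_le_of_val_mul k _ {6*k+4} ?_).trans (Finset.card_singleton _).le
  intro t ht
  simp only [cB, mul_add, c_inv] at ht
  generalize ((2*k+1 : ℕ) : ZMod (6*k+5)) * t = u at *
  have hlt := ZMod.val_lt u
  have := val_cases k 1 (by omega) u
  simp only [Finset.mem_singleton]
  simp only [Nat.even_iff] at ht
  split_ifs at ht <;> omega

theorem cB_l (k : ℕ) : (∑ t, if cB k t = cB k (t + ((3*k+2 : ℕ) : ZMod (6*k+5))) then 1 else 0 : ℕ) ≤ 4*k+3 := by
  refine (card_le_of_val_mul k _ (Finset.range (4*k+3)) ?_).trans (Finset.card_range _).le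
  intro t ht
  simp only [cB, mul_add, c_l] at ht
  generalize ((2*k+1 : ℕ) : ZMod (6*k+5)) * t = u at *
  have hlt := ZMod.val_lt u
  have := val_cases k (2*k+2) (by omega) u
  simp only [Finset.mem_range]
  simp only [Nat.even_iff] at ht
  split_ifs at ht <;> omega

theorem shift_eq (k : ℕ) (c : ZMod (6*k+5) → Fin 2) (D : ZMod (6*k+5)) (a b : ZMod (6*k+5))
    (h : b = a + D ∨ a = b + D) :
    (∑ r, if c (a + r) = c (b + r) then 1 else 0 : ℕ) = ∑ t, if c t = c (t + D) then 1 else 0 := by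
  rcases h with rfl | rfl
  · rw [← Equiv.sum_comp (Equiv.addLeft a) (fun t => if c t = c (t + D) then 1 else 0 : ZMod (6*k+5) → ℕ)]
    refine Finset.sum_congr rfl (fun r _ => ?_)
    simp only [Equiv.coe_addLeft]
    have := add_right_comm a D r
    simp only [this]
    congr
  · rw [← Equiv.sum_comp (Equiv.addLeft b) (fun t => if c t = c (t + D) then 1 else 0 : ZMod (6*k+5) → ℕ)]
    refine Finset.sum_congr rfl (fun r _ => ?_)
    simp only [Equiv.coe_addLeft]
    have := add_right_comm b D r
    simp only [this, eq_comm (a := c (b + r + D))]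
    congr

theorem adj_count (k : ℕ) (i j : Fin (6*k+5)) (h : (circK (6*k+5) (3*k+1)).Adj i j) :
    (2*k+1) * (∑ r, if cA k (phi k i + r) = cA k (phi k j + r) then 1 else 0 : ℕ)
      + (∑ r, if cB k (phi k i + r) = cB k (phi k j + r) then 1 else 0 : ℕ) ≤ 6*k+4 := by
  obtain ⟨D, hD, h⟩ := adj_phi k i j h
  rw [shift_eq k (cA k) D _ _ h, shift_eq k (cB k) D _ _ h]
  rcases hD with rfl | rfl
  · have h1 := cA_h k
    have h2 := cB_h k
    nlinarith
  · have h1 := cA_l k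
    have h2 := cB_l k
    nlinarith

theorem flip_sum (k : ℕ) (P : ZMod (6*k+5) → Prop) [DecidablePred P] [DecidablePred fun r => ¬ P r] :
    (∑ r, if ¬ P r then 1 else 0 : ℝ) = (6*k+5) - ((∑ r, if P r then 1 else 0 : ℕ) : ℝ) := by
  have : ∀ r, (if ¬ P r then 1 else 0 : ℝ) = 1 - ((if P r then 1 else 0 : ℕ) : ℝ) := by
    intro r; by_cases h : P r <;> simp [h]
  rw [Finset.sum_congr rfl (fun r _ => this r), Finset.sum_sub_distrib, Nat.cast_sum]
  simp [ZMod.card]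

theorem cutWeight_eq {α β : Type} [Fintype α] (G : SimpleGraph α) (H : SimpleGraph β)
    (w : Sym2 α → ℚ) (f : α → β) : cutWeight G H w f =
    ∑ e ∈ Finset.univ.filter (fun e : Sym2 α => e ∈ G.edgeSet),
      (w e : ℝ) * (if Sym2.map f e ∈ H.edgeSet then 1 else 0) := by
  unfold cutWeight
  rw [← Finset.filter_filter, Finset.sum_filter]
  refine Finset.sum_congr rfl (fun e _ => ?_)
  split_ifs <;> simp

theorem le_mc {α β : Type} [Fintype α] [Finite β] (G : SimpleGraph α) (H : SimpleGraph β)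
    (w : Sym2 α → ℚ) (f : α → β) : cutWeight G H w f ≤ mcMax H G w :=
  le_ciSup (f := fun f : α → β => cutWeight G H w f) (Set.finite_range _).bddAbove f

theorem lower_cut (k n : ℕ) (G : SimpleGraph (Fin n)) (w : Sym2 (Fin n) → ℚ)
    (hw : ∀ e ∈ G.edgeSet, 0 < w e) (f : Fin n → Fin (6*k+5)) :
    ((2*k+2)*(6*k+5) - (6*k+4) : ℝ) * cutWeight G (circK (6*k+5) (3*k+1)) w f ≤
      (2*k+2)*(6*k+5) * mcMax K2 G w := by
  have h1 : (2*k+1 : ℝ) * ∑ r : ZMod (6*k+5), cutWeight G K2 w (fun v => cA k (phi k (f v) + r)) +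
      ∑ r : ZMod (6*k+5), cutWeight G K2 w (fun v => cB k (phi k (f v) + r)) ≤
      (2*k+2)*(6*k+5) * mcMax K2 G w := by
    have hA : ∑ r : ZMod (6*k+5), cutWeight G K2 w (fun v => cA k (phi k (f v) + r)) ≤
        (6*k+5) * mcMax K2 G w := by
      refine (Finset.sum_le_sum (fun r _ => le_mc G K2 w _)).trans ?_
      simp [ZMod.card]
    have hB : ∑ r : ZMod (6*k+5), cutWeight G K2 w (fun v => cB k (phi k (f v) + r)) ≤
        (6*k+5) * mcMax K2 G w := by
      refine (Finset.sum_le_sum (fun r _ => le_mc G K2 w _)).trans ?_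
      simp [ZMod.card]
    have := mul_le_mul_of_nonneg_left hA (by positivity : (0:ℝ) ≤ 2*k+1)
    linarith
  refine le_trans ?_ h1
  simp only [cutWeight_eq]
  rw [Finset.sum_comm, Finset.sum_comm (s := (Finset.univ : Finset (ZMod (6*k+5))))]
  rw [Finset.mul_sum, Finset.mul_sum, ← Finset.sum_add_distrib]
  refine Finset.sum_le_sum (fun e he => ?_)
  have he' : e ∈ G.edgeSet := by simpa using he
  have hwe : (0:ℝ) < w e := by exact_mod_cast hw e he'
  rw [← Finset.mul_sum, ← Finset.mul_sum]
  have : ((2*k+2)*(6*k+5) - (6*k+4) : ℝ) * (if Sym2.map f e ∈ (circK (6*k+5) (3*k+1)).edgeSet then 1 else 0)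
     ≤ (2*k+1) * (∑ r : ZMod (6*k+5), if Sym2.map (fun v => cA k (phi k (f v) + r)) e ∈ K2.edgeSet then 1 else 0)
      + (∑ r : ZMod (6*k+5), if Sym2.map (fun v => cB k (phi k (f v) + r)) e ∈ K2.edgeSet then 1 else 0) := by
    split_ifs with hh
    · induction e using Sym2.ind with
      | _ u v =>
        simp only [Sym2.map_mk, SimpleGraph.mem_edgeSet] at hh ⊢
        have h2 := adj_count k _ _ hh
        simp only [K2, SimpleGraph.top_adj, ne_eq]
        rw [flip_sum, flip_sum]
        have h3 : ((2*k+1 : ℝ)) * ((∑ r, if cA k (phi k (f u) + r) = cA k (phi k (f v) + r) then 1 else 0 : ℕ) : ℝ)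
      + ((∑ r, if cB k (phi k (f u) + r) = cB k (phi k (f v) + r) then 1 else 0 : ℕ) : ℝ) ≤ 6*k+4 := by
          exact_mod_cast h2
        linarith
    · simp only [mul_zero]
      positivity
  have := mul_le_mul_of_nonneg_left this hwe.le
  linarith

theorem mcN_pos (k n : ℕ) (G : SimpleGraph (Fin n)) (w : Sym2 (Fin n) → ℚ)
    (hne : G.edgeSet.Nonempty) (hw : ∀ e ∈ G.edgeSet, 0 < w e) :
    0 < mcMax (circK (6*k+5) (3*k+1)) G w := by
  obtain ⟨e, he⟩ := hne
  induction e using Sym2.ind with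
  | _ u v =>
    have huv : u ≠ v := G.ne_of_adj he
    refine lt_of_lt_of_le ?_ (le_mc G _ w (fun z => if z = u then psi k 0 else
      psi k (0 + ((3*k+1 : ℕ) : ZMod (6*k+5)))))
    unfold cutWeight
    refine Finset.sum_pos (fun e he => ?_) ⟨s(u,v), ?_⟩
    · simp only [Finset.mem_filter] at he
      exact_mod_cast hw e he.2.1
    · simp only [Finset.mem_filter, Finset.mem_univ, true_and]
      refine ⟨he, ?_⟩
      simp only [Sym2.map_mk, SimpleGraph.mem_edgeSet, if_true, if_neg huv.symm]
      exact adj_psi k _ (Or.inl rfl) 0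

/-- extremal weights -/
def wt (k : ℕ) (e : Sym2 (Fin (6*k+5))) : ℚ :=
  ∑ t : ZMod (6*k+5), ((2*k+1) * (if e = s(psi k t, psi k (t + ((3*k+1 : ℕ) : ZMod (6*k+5)))) then 1 else 0)
    + (if e = s(psi k t, psi k (t + ((3*k+2 : ℕ) : ZMod (6*k+5)))) then 1 else 0))

theorem wt_pos (k : ℕ) (e : Sym2 (Fin (6*k+5))) (he : e ∈ (circK (6*k+5) (3*k+1)).edgeSet) :
    0 < wt k e := by
  have main : ∀ i (D : ℕ), (D = 3*k+1 ∨ D = 3*k+2) → e = s(psi k i, psi k (i + (D : ZMod (6*k+5)))) →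
      0 < wt k e := by
    intro i D hD h
    unfold wt
    refine Finset.sum_pos' (fun t _ => by positivity) ⟨i, Finset.mem_univ _, ?_⟩
    rcases hD with rfl | rfl
    · rw [if_pos h]; positivity
    · rw [if_pos h]; positivity
  induction e using Sym2.ind with
  | _ i j =>
    obtain ⟨D, hD, h⟩ := adj_phi k i j he
    rcases h with h | h
    · exact main (phi k i) D hD (by rw [← h, psi_phi, psi_phi])
    · exact main (phi k j) D hD (by rw [← h, psi_phi, psi_phi, Sym2.eq_swap])

theorem wt_cut (k : ℕ) {β : Type} (H : SimpleGraph β) (f : Fin (6*k+5) → β) :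
    cutWeight (circK (6*k+5) (3*k+1)) H (wt k) f =
     (2*k+1) * (∑ t : ZMod (6*k+5), if H.Adj (f (psi k t)) (f (psi k (t + ((3*k+1 : ℕ) : ZMod (6*k+5))))) then 1 else 0)
    + ∑ t : ZMod (6*k+5), if H.Adj (f (psi k t)) (f (psi k (t + ((3*k+2 : ℕ) : ZMod (6*k+5))))) then 1 else 0 := by
  unfold cutWeight wt
  simp only [Rat.cast_sum, Rat.cast_add, Rat.cast_mul, apply_ite (Rat.cast : ℚ → ℝ), Rat.cast_one, Rat.cast_zero, Rat.cast_ofNat, Rat.cast_natCast]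
  rw [Finset.sum_comm, Finset.mul_sum, ← Finset.sum_add_distrib]
  refine Finset.sum_congr rfl (fun t _ => ?_)
  rw [Finset.sum_add_distrib, ← Finset.mul_sum, Finset.sum_ite_eq', Finset.sum_ite_eq']
  have a1 := adj_psi k _ (Or.inl rfl) t
  have a2 := adj_psi k _ (Or.inr rfl) t
  simp only [Finset.mem_filter, Finset.mem_univ, true_and, Sym2.map_mk, SimpleGraph.mem_edgeSet, a1, a2]

theorem stmt2 (k : ℕ) (hk : 1 ≤ k) :
    sVal K2 (circK (6*k+5) (3*k+1)) = (6*(k:ℝ)^2+8*(k:ℝ)+3) / (6*(k:ℝ)^2+11*(k:ℝ)+5) ∧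
    sVal K2 (circK (6*k+5) (3*k+1)) = 1 - (3*(k:ℝ)+2) / (((k:ℝ)+1)*(6*(k:ℝ)+5)) := by
  have e : (6*(k:ℝ)^2+8*(k:ℝ)+3) / (6*(k:ℝ)^2+11*(k:ℝ)+5) = 1 - (3*(k:ℝ)+2) / (((k:ℝ)+1)*(6*(k:ℝ)+5)) := by
    have : (6*(k:ℝ)^2+11*(k:ℝ)+5) = ((k:ℝ)+1)*(6*(k:ℝ)+5) := by ring
    rw [this]
    field_simp
    ring
  rw [← e, and_self]
  have hlow : ∀ x ∈ { x : ℝ | ∃ (n : ℕ) (G : SimpleGraph (Fin n)) (w : Sym2 (Fin n) → ℚ),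
    G.edgeSet.Nonempty ∧ (∀ e ∈ G.edgeSet, 0 < w e) ∧
    x = mcMax K2 G w / mcMax (circK (6*k+5) (3*k+1)) G w },
      (6*(k:ℝ)^2+8*(k:ℝ)+3) / (6*(k:ℝ)^2+11*(k:ℝ)+5) ≤ x := by
    rintro x ⟨n, G, w, hne, hw, rfl⟩
    rw [div_le_div_iff₀ (by positivity) (mcN_pos k n G w hne hw)]
    obtain ⟨f, hf⟩ := exists_eq_ciSup_of_finite (f := fun f : Fin n → Fin (6*k+5) =>
      cutWeight G (circK (6*k+5) (3*k+1)) w f)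
    have := lower_cut k n G w hw f
    have hf' : cutWeight G (circK (6*k+5) (3*k+1)) w f = mcMax (circK (6*k+5) (3*k+1)) G w := hf
    rw [hf'] at this
    linarith
  have hedge : (circK (6*k+5) (3*k+1)).Adj _ _ := adj_psi k _ (Or.inl rfl) 0
  have hmem : mcMax K2 (circK (6*k+5) (3*k+1)) (wt k) / mcMax (circK (6*k+5) (3*k+1)) (circK (6*k+5) (3*k+1)) (wt k) ∈ { x : ℝ | ∃ (n : ℕ) (G : SimpleGraph (Fin n)) (w : Sym2 (Fin n) → ℚ),
    G.edgeSet.Nonempty ∧ (∀ e ∈ G.edgeSet, 0 < w e) ∧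
    x = mcMax K2 G w / mcMax (circK (6*k+5) (3*k+1)) G w } :=
    ⟨_, circK (6*k+5) (3*k+1), wt k, ⟨s(_, _), hedge⟩, wt_pos k, rfl⟩
  refine le_antisymm ((csInf_le ⟨_, hlow⟩ hmem).trans ?_) (le_csInf ⟨_, hmem⟩ hlow)
  have hN : (2*k+2)*(6*k+5) ≤ mcMax (circK (6*k+5) (3*k+1)) (circK (6*k+5) (3*k+1)) (wt k) := by
    refine le_trans (le_of_eq ?_) (le_mc _ _ _ id)
    rw [wt_cut]
    simp only [id, adj_psi k _ (Or.inl rfl), adj_psi k _ (Or.inr rfl), if_true]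
    simp [ZMod.card]
    ring
  have hM : mcMax K2 (circK (6*k+5) (3*k+1)) (wt k) ≤ (2*k+2)*(6*k+5) - (6*k+4) := by
    refine ciSup_le (fun f => ?_)
    rw [wt_cut]
    simp only [K2, SimpleGraph.top_adj, ne_eq]
    rw [flip_sum, flip_sum]
    have h2 := aux_comb k (fun t => f (psi k t))
    have h3 : (6*k+4 : ℝ) ≤ (2*k+1) * ((∑ t, if f (psi k t) = f (psi k (t + ((3*k+1 : ℕ) : ZMod (6*k+5)))) then 1 else 0 : ℕ) : ℝ)
      + ((∑ t, if f (psi k t) = f (psi k (t + ((3*k+2 : ℕ) : ZMod (6*k+5)))) then 1 else 0 : ℕ) : ℝ) := by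
      exact_mod_cast h2
    linarith
  have hpos : (0:ℝ) < (2*k+2)*(6*k+5) := by positivity
  rw [div_le_div_iff₀ (lt_of_lt_of_le hpos hN) (by positivity)]
  have hq : (0:ℝ) ≤ 6*(k:ℝ)^2+8*(k:ℝ)+3 := by positivity
  have h5 := mul_le_mul_of_nonneg_left hN hq
  have h6 := mul_le_mul_of_nonneg_right hM (by positivity : (0:ℝ) ≤ 6*(k:ℝ)^2+11*(k:ℝ)+5)
  refine h6.trans (le_trans (le_of_eq ?_) h5)
  ring
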